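/- arXiv:2402.04244 — 13 statements merged into one kernel-verified Lean document; each statement's English description precedes it below -/
import Mathlib

section
/- Let C be a preadditive category with finite biproducts, D a preadditive category, F : C ⥤ D an arbitrary functor, d a positive integer, x : Fin d → C with biproduct X, and for U ⊆ Fin d let ψ_U be as above and cr(U) := ∑_{V ⊆ U} (−1)^{|U|−|V|} F.map(ψ_V), an endomorphism of F(X). Then cr(U) equals the composite of F.map(ψ_U) with the product (composite, in any order, since the factors commute) over i ∈ U of the endomorphisms 𝟙_{F(X)} − F.map(ψ_{U∖{i}}). -/
open CategoryTheory CategoryTheory.Limits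

/-- `psi x U = ∑_{i ∈ U} π_i ≫ ι_i`, an endomorphism of the biproduct `⨁ x`. -/
noncomputable def psi {C : Type*} [Category C] [Preadditive C] [HasFiniteBiproducts C]
    {d : ℕ} (x : Fin d → C) (U : Finset (Fin d)) : (⨁ x) ⟶ (⨁ x) :=
  ∑ i ∈ U, biproduct.π x i ≫ biproduct.ι x i

/-- `cr F x U = ∑_{V ⊆ U} (−1)^{|U|−|V|} F.map (ψ_V)`, an endomorphism of `F(⨁ x)`. -/
noncomputable def cr {C : Type*} [Category C] [Preadditive C] [HasFiniteBiproducts C]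
    {D : Type*} [Category D] [Preadditive D] {d : ℕ} (F : C ⥤ D) (x : Fin d → C)
    (U : Finset (Fin d)) : F.obj (⨁ x) ⟶ F.obj (⨁ x) :=
  ∑ V ∈ U.powerset, ((-1 : ℤ) ^ (U.card - V.card)) • F.map (psi x V)

theorem psi_comp_psi {C : Type*} [Category C] [Preadditive C] [HasFiniteBiproducts C]
    {d : ℕ} (x : Fin d → C) (U V : Finset (Fin d)) :
    psi x U ≫ psi x V = psi x (U ∩ V) := by
  unfold psi
  rw [Preadditive.sum_comp, ← Finset.filter_mem_eq_inter, Finset.sum_filter]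
  refine Finset.sum_congr rfl fun i _ => ?_
  rw [Preadditive.comp_sum]
  have h (j : Fin d) : (biproduct.π x i ≫ biproduct.ι x i) ≫ biproduct.π x j ≫ biproduct.ι x j =
      if i = j then biproduct.π x i ≫ biproduct.ι x i else 0 := by
    split_ifs with hij
    · subst hij
      simp
    · simp [biproduct.ι_π_ne_assoc x hij]
  simp only [h, Finset.sum_ite_eq]

/-- Expansion of the product of the endomorphisms `𝟙 − F.map (ψ_{U∖{i}})` along a list `L`,
precomposed with `F.map (ψ_A)` for some `A ⊆ U`. -/
theorem map_psi_comp_foldr {C : Type*} [Category C] [Preadditive C] [HasFiniteBiproducts C]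
    {D : Type*} [Category D] [Preadditive D] {d : ℕ} (F : C ⥤ D) (x : Fin d → C)
    (U : Finset (Fin d)) (L : List (Fin d)) (hL : L.Nodup) (A : Finset (Fin d)) (hA : A ⊆ U) :
    F.map (psi x A) ≫
        (L.map fun i => 𝟙 (F.obj (⨁ x)) - F.map (psi x (U.erase i))).foldr
          (· ≫ ·) (𝟙 (F.obj (⨁ x))) =
      ∑ V ∈ L.toFinset.powerset, ((-1 : ℤ) ^ V.card) • F.map (psi x (A \ V)) := by
  induction L generalizing A with
  | nil => simp
  | cons i L ih =>
    obtain ⟨hi, hL⟩ := List.nodup_cons.mp hL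
    have hi' : i ∉ L.toFinset := by simpa using hi
    have hAi : A ∩ U.erase i = A.erase i := by
      rw [Finset.inter_erase, Finset.inter_eq_left.mpr hA]
    rw [List.map_cons, List.foldr_cons, Preadditive.sub_comp, Preadditive.comp_sub,
      Category.id_comp, ← Category.assoc, ← F.map_comp, psi_comp_psi, hAi, ih hL A hA,
      ih hL _ ((A.erase_subset i).trans hA), List.toFinset_cons,
      Finset.sum_powerset_insert hi', sub_eq_add_neg, ← Finset.sum_neg_distrib]
    congr 1
    refine Finset.sum_congr rfl fun V hV => ?_
    have hiV : i ∉ V := fun h => hi' (Finset.mem_powerset.mp hV h)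
    rw [Finset.card_insert_of_notMem hiV, pow_succ, mul_neg_one, neg_smul,
      Finset.sdiff_insert, Finset.erase_sdiff_comm]

/-- `cr U` equals the composite of `F.map (ψ_U)` with the product (composite in any order:
here taken along an arbitrary enumeration `L` of the elements of `U`) over `i ∈ U` of the
endomorphisms `𝟙 − F.map (ψ_{U∖{i}})`. -/
theorem cr_eq_comp {C : Type*} [Category C] [Preadditive C] [HasFiniteBiproducts C]
    {D : Type*} [Category D] [Preadditive D] {d : ℕ} (hd : 0 < d)
    (F : C ⥤ D) (x : Fin d → C) (U : Finset (Fin d)) (L : List (Fin d))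
    (hL : L.Nodup) (hLU : ∀ i, i ∈ L ↔ i ∈ U) :
    cr F x U =
      F.map (psi x U) ≫
        (L.map fun i => 𝟙 (F.obj (⨁ x)) - F.map (psi x (U.erase i))).foldr
          (· ≫ ·) (𝟙 (F.obj (⨁ x))) := by
  have hU : L.toFinset = U := by
    ext i
    simp [hLU]
  rw [map_psi_comp_foldr F x U L hL U subset_rfl, hU, cr]
  refine Finset.sum_bij' (fun V _ => U \ V) (fun V _ => U \ V) ?_ ?_ ?_ ?_ ?_
  · simp
  · simp
  · intro V hV
    exact Finset.sdiff_sdiff_eq_self (Finset.mem_powerset.mp hV)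
  · intro V hV
    exact Finset.sdiff_sdiff_eq_self (Finset.mem_powerset.mp hV)
  · intro V hV
    have hVU := Finset.mem_powerset.mp hV
    rw [Finset.card_sdiff_of_subset hVU, Finset.sdiff_sdiff_eq_self hVU]
end

section
/- Let C be a preadditive category with finite biproducts, D a preadditive category, F : C ⥤ D an arbitrary functor, d a positive integer, and x : Fin d → C with biproduct X. If U ⊆ Fin d contains an index i such that the object x i is a zero object of C, then the endomorphism cr(U) = ∑_{V ⊆ U} (−1)^{|U|−|V|} F.map(ψ_V) of F(X) is equal to zero. -/
open CategoryTheory CategoryTheory.Limits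

/-- Adjoining an index whose summand is a zero object does not change `psi`. -/
theorem psi_insert_of_isZero {C : Type*} [Category C] [Preadditive C] [HasFiniteBiproducts C]
    {d : ℕ} (x : Fin d → C) {V : Finset (Fin d)} {i : Fin d} (hiV : i ∉ V)
    (hzero : IsZero (x i)) : psi x (insert i V) = psi x V := by
  simp [psi, Finset.sum_insert hiV, hzero.eq_of_tgt (biproduct.π x i) 0]

/-- If `U` contains an index `i` such that `x i` is a zero object, then `cr U = 0`. -/
theorem cr_eq_zero_of_isZero {C : Type*} [Category C] [Preadditive C]
    [HasFiniteBiproducts C] {D : Type*} [Category D] [Preadditive D] {d : ℕ} (hd : 0 < d)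
    (F : C ⥤ D) (x : Fin d → C) (U : Finset (Fin d)) (i : Fin d) (hiU : i ∈ U)
    (hzero : IsZero (x i)) :
    cr F x U = 0 := by
  obtain ⟨W, hiW, rfl⟩ : ∃ W : Finset (Fin d), i ∉ W ∧ insert i W = U :=
    ⟨U.erase i, Finset.notMem_erase i U, Finset.insert_erase hiU⟩
  rw [cr, Finset.sum_powerset_insert hiW, ← Finset.sum_add_distrib]
  refine Finset.sum_eq_zero fun V hV => ?_
  have hVW : V ⊆ W := Finset.mem_powerset.mp hV
  have hiV : i ∉ V := fun h => hiW (hVW h)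
  rw [psi_insert_of_isZero x hiV hzero, Finset.card_insert_of_notMem hiW,
    Finset.card_insert_of_notMem hiV, Nat.add_sub_add_right,
    Nat.sub_add_comm (Finset.card_le_card hVW), pow_succ, ← add_smul]
  simp
end

section
/- For all positive integers i and j, the number μ(i,j,j) of good subsets of Fin i × Fin j of cardinality j equals Surj(j,i), the number of surjective functions from Fin j to Fin i. In particular μ(i,j,j) = 0 when i > j. -/
/-- `Surj m n` is the number of surjective functions from `Fin m` to `Fin n`. -/
noncomputable def Surj (m n : ℕ) : ℕ :=
  Nat.card {f : Fin m → Fin n // Function.Surjective f}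

/-- `mu i j l` is the number of good subsets of `Fin i × Fin j` of cardinality `l`,
where a subset is good if its projections onto `Fin i` and onto `Fin j` are both
surjective. -/
def mu (i j l : ℕ) : ℕ :=
  ((Finset.univ : Finset (Finset (Fin i × Fin j))).filter
    (fun U => U.image Prod.fst = Finset.univ ∧ U.image Prod.snd = Finset.univ ∧
      U.card = l)).card

/-- The number `μ(i,j,j)` of good subsets of `Fin i × Fin j` of cardinality `j` equals
`Surj(j,i)`, the number of surjections from `Fin j` to `Fin i`; in particular it is `0`
when `i > j`. -/
theorem mu_eq_surj (i j : ℕ) (hi : 0 < i) (hj : 0 < j) :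
    mu i j j = Surj j i ∧ (i > j → mu i j j = 0) := by
  have surj_card : mu i j j = Surj j i := by
    classical
    rw [mu, Surj, Nat.card_eq_fintype_card, Fintype.card_subtype]
    symm
    refine Finset.card_bij (fun f _ => Finset.univ.image fun x => (f x, x)) ?_ ?_ ?_
    · intro f hf
      have hf : Function.Surjective f := by simpa using hf
      simp only [Finset.mem_filter, Finset.mem_univ, true_and, Finset.image_image]
      refine ⟨Finset.image_univ_of_surjective hf,
        Finset.image_univ_of_surjective Function.surjective_id, ?_⟩
      rw [Finset.card_image_of_injective _ fun x y h => congrArg Prod.snd h, Finset.card_fin]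
    · intro f _ g _ h
      funext x
      have hx : (f x, x) ∈ Finset.univ.image fun x => (g x, x) := by
        rw [← h]
        exact Finset.mem_image_of_mem _ (Finset.mem_univ x)
      obtain ⟨y, -, hy⟩ := Finset.mem_image.mp hx
      obtain ⟨h₁, rfl⟩ := Prod.mk.inj hy
      exact h₁.symm
    · intro U hU
      obtain ⟨h_fst, h_snd, h_card⟩ : U.image Prod.fst = Finset.univ ∧
          U.image Prod.snd = Finset.univ ∧ U.card = j := by simpa using hU
      have h_mem (x : Fin j) : ∃ a, (a, x) ∈ U := by
        have hx : x ∈ U.image Prod.snd := h_snd ▸ Finset.mem_univ x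
        simpa using hx
      choose f hf using h_mem
      have hU_eq : Finset.univ.image (fun x => (f x, x)) = U := by
        refine Finset.eq_of_subset_of_card_le (by simpa [Finset.image_subset_iff] using hf) ?_
        rw [Finset.card_image_of_injective _ fun x y h => congrArg Prod.snd h,
          Finset.card_fin, h_card]
      refine ⟨f, ?_, hU_eq⟩
      rw [Finset.mem_filter]
      refine ⟨Finset.mem_univ f, fun a => ?_⟩
      have ha : a ∈ U.image Prod.fst := h_fst ▸ Finset.mem_univ a
      rw [← hU_eq] at ha
      simpa using ha
  refine ⟨surj_card, fun hij => ?_⟩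
  rw [surj_card, Surj, Nat.card_eq_zero]
  refine Or.inl ⟨fun f => ?_⟩
  have h_le := Fintype.card_le_of_surjective f.1 f.2
  simp only [Fintype.card_fin] at h_le
  omega
end

section
/- For all positive integers i, j and every natural number k, the number μ(i,j,k) of good subsets of Fin i × Fin j of cardinality k satisfies, as an identity in ℤ, μ(i,j,k) = ∑_{s=0}^{i} ∑_{t=0}^{j} (−1)^{s+t} · C((i−s)·(j−t), k) · C(i,s) · C(j,t), where C(a,b) denotes the binomial coefficient. -/
/-- The alternating sum over the sets disjoint from `A` detects whether `A` is everything. -/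
theorem sum_neg_one_pow_card_disjoint {α : Type*} [Fintype α] [DecidableEq α] (A : Finset α) :
    (∑ S : Finset α, if Disjoint S A then (-1 : ℤ) ^ S.card else 0) =
      if A = Finset.univ then 1 else 0 := by
  have h : (Finset.univ.filter fun S : Finset α => Disjoint S A) = Aᶜ.powerset := by
    ext S
    simp [Finset.subset_compl_iff_disjoint_right]
  rw [← Finset.sum_filter, h, Finset.sum_powerset_neg_one_pow_card]
  simp

/-- The `k`-subsets of `α × β` whose projections avoid `S` and `T` are the `k`-subsets of
`Sᶜ ×ˢ Tᶜ`. -/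
theorem card_filter_disjoint_image {α β : Type*} [Fintype α] [DecidableEq α] [Fintype β]
    [DecidableEq β] (k : ℕ) (S : Finset α) (T : Finset β) :
    ((Finset.univ.powersetCard k : Finset (Finset (α × β))).filter fun U =>
      Disjoint S (U.image Prod.fst) ∧ Disjoint T (U.image Prod.snd)).card =
      ((Fintype.card α - S.card) * (Fintype.card β - T.card)).choose k := by
  rw [← Finset.card_compl, ← Finset.card_compl, ← Finset.card_product, ← Finset.card_powersetCard]
  congr 1
  ext U
  simp only [Finset.mem_filter, Finset.mem_powersetCard,
    Finset.disjoint_right, Finset.mem_image, Finset.subset_iff, Finset.mem_product,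
    Finset.mem_compl]
  grind

/-- Inclusion-exclusion formula:
`μ(i,j,k) = ∑_{s,t} (−1)^{s+t} C((i−s)(j−t), k) C(i,s) C(j,t)`. -/
theorem mu_eq_sum (i j : ℕ) (hi : 0 < i) (hj : 0 < j) (k : ℕ) :
    (mu i j k : ℤ) =
      ∑ s ∈ Finset.range (i + 1), ∑ t ∈ Finset.range (j + 1),
        (-1 : ℤ) ^ (s + t) * (((i - s) * (j - t)).choose k : ℤ) *
          (i.choose s : ℤ) * (j.choose t : ℤ) := by
  have by_card (n : ℕ) (f : ℕ → ℤ) :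
      ∑ S : Finset (Fin n), f S.card = ∑ s ∈ Finset.range (n + 1), (n.choose s : ℤ) * f s := by
    simpa using Finset.sum_powerset_apply_card f (x := (Finset.univ : Finset (Fin n)))
  calc (mu i j k : ℤ)
      = ∑ U ∈ (Finset.univ.powersetCard k : Finset (Finset (Fin i × Fin j))),
          (if U.image Prod.fst = Finset.univ then (1 : ℤ) else 0) *
            (if U.image Prod.snd = Finset.univ then 1 else 0) := by
        simp only [ite_zero_mul_ite_zero, mul_one, Finset.sum_boole, mu]
        congr 2
        ext U
        simp only [Finset.mem_filter, Finset.mem_univ, true_and, Finset.mem_powersetCard,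
          Finset.subset_univ]
        tauto
    _ = ∑ S : Finset (Fin i), ∑ T : Finset (Fin j), (-1 : ℤ) ^ (S.card + T.card) *
          (((i - S.card) * (j - T.card)).choose k : ℤ) := by
        simp only [← sum_neg_one_pow_card_disjoint, Finset.sum_mul_sum]
        rw [Finset.sum_comm]
        refine Finset.sum_congr rfl fun S _ => ?_
        rw [Finset.sum_comm]
        refine Finset.sum_congr rfl fun T _ => ?_
        have h := card_filter_disjoint_image k S T
        simp only [Fintype.card_fin] at h
        rw [← h]
        simp only [ite_zero_mul_ite_zero, ← pow_add]
        rw [← Finset.sum_filter, Finset.sum_const, nsmul_eq_mul, mul_comm]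
    _ = _ := by
        rw [by_card i fun s => ∑ T : Finset (Fin j), (-1 : ℤ) ^ (s + T.card) *
          (((i - s) * (j - T.card)).choose k : ℤ)]
        refine Finset.sum_congr rfl fun s _ => ?_
        rw [by_card j fun t => (-1 : ℤ) ^ (s + t) * (((i - s) * (j - t)).choose k : ℤ),
          Finset.mul_sum]
        exact Finset.sum_congr rfl fun t _ => by ring
end

section
/- For all positive integers i, j, k, one has Surj(k,i) · Surj(k,j) = ∑_{l=1}^{i·j} μ(i,j,l) · Surj(k,l), where Surj(m,n) is the number of surjections from Fin m to Fin n and μ(i,j,l) is the number of good subsets of Fin i × Fin j of cardinality l. -/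
/-- Surjections onto a finite type are counted by `Surj`. -/
theorem card_surjective_eq_surj {β : Type*} [Fintype β] (k : ℕ) :
    Nat.card {g : Fin k → β // Function.Surjective g} = Surj k (Fintype.card β) :=
  Nat.card_congr <| (Equiv.arrowCongr (Equiv.refl _) (Fintype.equivFin β)).subtypeEquiv fun g => by
    simp [Equiv.arrowCongr]

/-- Functions with image `U` are the surjections onto `U`. -/
theorem card_image_eq {α : Type*} [Fintype α] [DecidableEq α] (k : ℕ) (U : Finset α) :
    (Finset.univ.filter fun f : Fin k → α => Finset.univ.image f = U).card = Surj k U.card := by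
  rw [← Fintype.card_coe U, ← card_surjective_eq_surj, ← Fintype.card_subtype,
    ← Nat.card_eq_fintype_card]
  refine Nat.card_congr
    { toFun := fun f => ⟨fun x => ⟨f.1 x, by simp [← f.2]⟩, ?_⟩
      invFun := fun g => ⟨fun x => (g.1 x : α), ?_⟩
      left_inv := fun _ => rfl
      right_inv := fun _ => rfl }
  · rintro ⟨y, hy⟩
    obtain ⟨x, -, hx⟩ := Finset.mem_image.1 (f.2.symm ▸ hy)
    exact ⟨x, Subtype.ext hx⟩
  · ext y
    simp only [Finset.mem_image, Finset.mem_univ, true_and]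
    constructor
    · rintro ⟨x, rfl⟩
      exact (g.1 x).2
    · intro hy
      obtain ⟨x, hx⟩ := g.2 ⟨y, hy⟩
      exact ⟨x, by rw [hx]⟩

/-- Pairs of surjections are the maps into the product whose image projects onto both factors. -/
theorem surj_mul_surj_eq_card (i j k : ℕ) :
    Surj k i * Surj k j = (Finset.univ.filter fun f : Fin k → Fin i × Fin j =>
      (Finset.univ.image f).image Prod.fst = Finset.univ ∧
        (Finset.univ.image f).image Prod.snd = Finset.univ).card := by
  rw [Surj, Surj, ← Nat.card_prod, ← Fintype.card_subtype, ← Nat.card_eq_fintype_card]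
  refine Nat.card_congr (Equiv.symm ?_)
  refine Equiv.trans ?_ (Equiv.subtypeProdEquivProd
    (p := fun f : Fin k → Fin i => Function.Surjective f)
    (q := fun f : Fin k → Fin j => Function.Surjective f))
  refine (Equiv.arrowProdEquivProdArrow (Fin k) (fun _ => Fin i) (fun _ => Fin j)).subtypeEquiv
    fun f => ?_
  simp only [Finset.image_image, Finset.eq_univ_iff_forall, Finset.mem_image, Finset.mem_univ,
    true_and]
  rfl

/-- `Surj(k,i) · Surj(k,j) = ∑_{l=1}^{ij} μ(i,j,l) · Surj(k,l)`. -/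
theorem surj_mul_surj (i j k : ℕ) (hi : 0 < i) (hj : 0 < j) (hk : 0 < k) :
    Surj k i * Surj k j = ∑ l ∈ Finset.Icc 1 (i * j), mu i j l * Surj k l := by
  rw [surj_mul_surj_eq_card]
  set good := Finset.univ.filter fun U : Finset (Fin i × Fin j) =>
    U.image Prod.fst = Finset.univ ∧ U.image Prod.snd = Finset.univ with hgood
  have hcard : ∀ U ∈ good, U.card ∈ Finset.Icc 1 (i * j) := by
    intro U hU
    have hfst := (Finset.mem_filter.1 hU).2.1
    refine Finset.mem_Icc.2 ⟨Finset.card_pos.2 ?_, by simpa using U.card_le_univ⟩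
    have : (U.image Prod.fst).Nonempty := hfst ▸ ⟨⟨0, hi⟩, Finset.mem_univ _⟩
    exact Finset.image_nonempty.1 this
  have hfiber : ∀ U ∈ good, ((Finset.univ.filter fun f : Fin k → Fin i × Fin j =>
      (Finset.univ.image f).image Prod.fst = Finset.univ ∧
        (Finset.univ.image f).image Prod.snd = Finset.univ).filter
          fun f => Finset.univ.image f = U).card = Surj k U.card := by
    intro U hU
    rw [← card_image_eq, Finset.filter_filter]
    congr 1
    refine Finset.filter_congr fun f _ => ⟨And.right, ?_⟩
    rintro rfl
    exact ⟨(Finset.mem_filter.1 hU).2, rfl⟩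
  rw [Finset.card_eq_sum_card_fiberwise (f := fun f => Finset.univ.image f) (t := good)
      (fun f hf => by simpa [hgood] using hf),
    Finset.sum_congr rfl hfiber, ← Finset.sum_fiberwise_of_maps_to hcard]
  refine Finset.sum_congr rfl fun l _ => ?_
  rw [Finset.sum_congr rfl fun U hU => by rw [(Finset.mem_filter.1 hU).2], Finset.sum_const,
    smul_eq_mul, mu, hgood, Finset.filter_filter]
  simp only [and_assoc]
end

section
/- Fix a positive integer d. For 1 ≤ j ≤ d let v_j ∈ (Fin d → ℤ) be the vector whose k-th entry (1 ≤ k ≤ d) is Surj(k,j), the number of surjections from Fin k to Fin j. Then the quotient of the abelian group (Fin d → ℤ) by the subgroup generated by v_1, …, v_d is isomorphic, as an abelian group, to the product ∏_{k=1}^{d} ℤ/(k!)ℤ. -/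
theorem Surj_self (n : ℕ) : Surj n n = n.factorial := by
  have e : {f : Fin n → Fin n // Function.Surjective f} ≃ Equiv.Perm (Fin n) :=
    (Equiv.subtypeEquivRight fun f => Finite.surjective_iff_bijective).trans
      (Equiv.ofBijective (fun f => Equiv.ofBijective f.1 f.2)
        ⟨fun f g h => Subtype.ext (congrArg (fun σ : Equiv.Perm (Fin n) => (σ : Fin n → Fin n)) h),
          fun σ => ⟨⟨σ, σ.bijective⟩, Equiv.ext fun _ => rfl⟩⟩)
  rw [Surj, Nat.card_congr e, Nat.card_perm, Nat.card_fin]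

theorem Surj_eq_zero_of_lt {m n : ℕ} (h : m < n) : Surj m n = 0 := by
  have : IsEmpty {f : Fin m → Fin n // Function.Surjective f} :=
    ⟨fun f => h.not_ge (by simpa using Fintype.card_le_of_surjective f.1 f.2)⟩
  exact Nat.card_of_isEmpty

theorem factorial_dvd_Surj (m n : ℕ) : n.factorial ∣ Surj m n := by
  let : MulAction (Equiv.Perm (Fin n)) {f : Fin m → Fin n // Function.Surjective f} :=
    { smul := fun σ f => ⟨σ ∘ f.1, σ.surjective.comp f.2⟩
      one_smul := fun _ => rfl
      mul_smul := fun _ _ _ => rfl }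
  have free (f : {f : Fin m → Fin n // Function.Surjective f}) :
      MulAction.stabilizer (Equiv.Perm (Fin n)) f = ⊥ := by
    refine (Subgroup.eq_bot_iff_forall _).2 fun σ hσ => Equiv.ext fun i => ?_
    obtain ⟨a, rfl⟩ := f.2 i
    exact congrFun (congrArg Subtype.val (MulAction.mem_stabilizer_iff.1 hσ)) a
  rw [Surj, Nat.card_congr (MulAction.selfEquivOrbitsQuotientProd free), Nat.card_prod,
    Nat.card_perm, Nat.card_fin]
  exact dvd_mul_left _ _

/-- If the columns of a matrix are multiples `a j` of the columns of a matrix of unit determinant,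
then its cokernel is the product of the groups `ℤ/(a j)ℤ`. -/
theorem nonempty_quotient_closure_addEquiv {ι : Type*} [Fintype ι] [DecidableEq ι]
    (S : Matrix ι ι ℤ) (hS : IsUnit S.det) (a : ι → ℕ) :
    Nonempty (((ι → ℤ) ⧸ AddSubgroup.closure (Set.range fun j k => S k j * (a j : ℤ)))
      ≃+ ∀ k, ZMod (a k)) := by
  let φ : (ι → ℤ) →+ ∀ k, ZMod (a k) :=
    { toFun := fun x k => ((S⁻¹.mulVec x k : ℤ) : ZMod (a k))
      map_zero' := by ext; simp
      map_add' := fun x y => by ext; simp [Matrix.mulVec_add] }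
  have hφ : Function.Surjective φ := fun y => by
    choose z hz using fun k => ZMod.intCast_surjective (y k)
    refine ⟨S.mulVec z, funext fun k => ?_⟩
    simp [φ, Matrix.mulVec_mulVec, Matrix.nonsing_inv_mul S hS, hz]
  have hcol (j : ι) : (fun k => S k j * (a j : ℤ)) = S.mulVec (Pi.single j (a j : ℤ)) := by
    ext k
    simp [Matrix.mulVec_single]
  have hker : AddSubgroup.closure (Set.range fun j k => S k j * (a j : ℤ)) = φ.ker := by
    apply le_antisymm
    · rw [AddSubgroup.closure_le]
      rintro _ ⟨j, rfl⟩
      beta_reduce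
      rw [hcol]
      refine funext fun k => ?_
      change ((S⁻¹.mulVec (S.mulVec (Pi.single j (a j : ℤ))) k : ℤ) : ZMod (a k)) = 0
      rw [Matrix.mulVec_mulVec, Matrix.nonsing_inv_mul S hS, Matrix.one_mulVec]
      rcases eq_or_ne k j with rfl | h <;> simp [*]
    · intro x hx
      have hdvd (k : ι) : (a k : ℤ) ∣ S⁻¹.mulVec x k :=
        (ZMod.intCast_zmod_eq_zero_iff_dvd _ _).1 (congrFun hx k)
      choose c hc using hdvd
      have hx' : x = ∑ j, c j • fun k => S k j * (a j : ℤ) := by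
        calc x = S.mulVec (S⁻¹.mulVec x) := by
              rw [Matrix.mulVec_mulVec, Matrix.mul_nonsing_inv S hS, Matrix.one_mulVec]
          _ = _ := by
              ext k
              rw [Matrix.mulVec, dotProduct]
              simp only [Finset.sum_apply, Pi.smul_apply, smul_eq_mul, hc]
              exact Finset.sum_congr rfl fun j _ => by ring
      rw [hx']
      exact sum_mem fun j _ => zsmul_mem (AddSubgroup.subset_closure (Set.mem_range_self j)) _
  exact ⟨(QuotientAddGroup.quotientAddEquivOfEq hker).trans
    (QuotientAddGroup.quotientKerEquivOfSurjective φ hφ)⟩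

/-- The quotient of `ℤ^d` by the subgroup generated by the vectors
`v_j = (Surj(k,j))_{1 ≤ k ≤ d}`, for `1 ≤ j ≤ d`, is isomorphic as an abelian group to
`∏_{k=1}^d ℤ/(k!)ℤ`. -/
theorem quotient_iso_prod_zmod (d : ℕ) (hd : 0 < d) :
    Nonempty (((Fin d → ℤ) ⧸ AddSubgroup.closure
        (Set.range fun j : Fin d => fun k : Fin d => (Surj (k.1 + 1) (j.1 + 1) : ℤ)))
      ≃+ ∀ k : Fin d, ZMod (Nat.factorial (k.1 + 1))) := by
  let S : Matrix (Fin d) (Fin d) ℤ := Matrix.of fun k j =>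
    ((Surj (k.1 + 1) (j.1 + 1) / (j.1 + 1).factorial : ℕ) : ℤ)
  have hS : S.det = 1 := by
    rw [Matrix.det_of_isLowerTriangular S fun i j hij => ?_]
    · exact Finset.prod_eq_one fun i _ => by
        simp only [S, Matrix.of_apply, Surj_self, Nat.div_self (Nat.factorial_pos _), Nat.cast_one]
    · have hij : i < j := hij
      simp [S, Surj_eq_zero_of_lt (Nat.succ_lt_succ hij)]
  have hcol : (fun j k : Fin d => (Surj (k.1 + 1) (j.1 + 1) : ℤ)) =
      fun j k => S k j * ((j.1 + 1).factorial : ℤ) := by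
    ext j k
    simp only [S, Matrix.of_apply]
    exact_mod_cast (Nat.div_mul_cancel (factorial_dvd_Surj _ _)).symm
  rw [hcol]
  exact nonempty_quotient_closure_addEquiv S (hS ▸ isUnit_one) fun j => (j.1 + 1).factorial
end

section
/- Let p be a prime and let i, j be positive integers such that p − 1 divides j − i. Then for every positive integer ℓ, Surj(i,ℓ) ≡ Surj(j,ℓ) (mod p), where Surj(m,n) denotes the number of surjective functions from Fin m to Fin n. -/
open Finset in
/-- The inclusion–exclusion formula for the number of surjections. -/
theorem Surj_eq_sum (m n : ℕ) :
    (Surj m n : ℤ) = ∑ t : Finset (Fin n), (-1) ^ #t * (#tᶜ : ℤ) ^ m := by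
  have key := inclusion_exclusion_card_inf_compl (univ : Finset (Fin n))
    fun b ↦ (Fintype.piFinset fun _ : Fin m ↦ ({b}ᶜ : Finset (Fin n)))
  have hsurj : Surj m n =
      #((univ : Finset (Fin n)).inf
        fun b ↦ (Fintype.piFinset fun _ : Fin m ↦ ({b}ᶜ : Finset (Fin n)))ᶜ) := by
    classical
    rw [Surj, Nat.card_eq_fintype_card, Fintype.card_subtype]
    congr 1
    ext f
    rw [mem_filter_univ]
    simp [Finset.mem_inf, Function.Surjective]
  rw [hsurj, key, powerset_univ]
  refine sum_congr rfl fun t _ ↦ ?_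
  have hinf : (t.inf fun b ↦ Fintype.piFinset fun _ : Fin m ↦ ({b}ᶜ : Finset (Fin n))) =
      Fintype.piFinset fun _ ↦ tᶜ := by
    ext f
    simp only [Finset.mem_inf, Fintype.mem_piFinset, mem_compl, mem_singleton]
    exact ⟨fun h a ha ↦ h _ ha a rfl, fun h b hb a hab ↦ h a (hab ▸ hb)⟩
  rw [hinf, Fintype.card_piFinset_const]
  push_cast
  rfl

theorem ZMod.pow_eq_pow_of_sub_one_dvd {p : ℕ} [Fact p.Prime] {i j : ℕ} (hi : i ≠ 0) (hj : j ≠ 0)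
    (h : ((p : ℤ) - 1) ∣ ((j : ℤ) - (i : ℤ))) (x : ZMod p) : x ^ i = x ^ j := by
  obtain rfl | hx := eq_or_ne x 0
  · rw [zero_pow hi, zero_pow hj]
  · obtain ⟨k, hk⟩ := h
    have hone : x ^ ((p : ℤ) - 1) = 1 := by
      rw [← Nat.cast_pred (Fact.out : p.Prime).pos, zpow_natCast, ZMod.pow_card_sub_one_eq_one hx]
    rw [← zpow_natCast, ← zpow_natCast, eq_add_of_sub_eq hk, zpow_add₀ hx, zpow_mul, hone,
      one_zpow, one_mul]

/-- If `p` is prime and `p − 1` divides `j − i`, then for every positive integer `ℓ`,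
`Surj(i,ℓ) ≡ Surj(j,ℓ) (mod p)`. -/
theorem surj_modEq (p : ℕ) (hp : p.Prime) (i j : ℕ) (hi : 0 < i) (hj : 0 < j)
    (hdvd : ((p : ℤ) - 1) ∣ ((j : ℤ) - (i : ℤ))) :
    ∀ ℓ : ℕ, 0 < ℓ → (Surj i ℓ : ℤ) ≡ (Surj j ℓ : ℤ) [ZMOD (p : ℤ)] := by
  intro ℓ _
  have : Fact p.Prime := ⟨hp⟩
  rw [← ZMod.intCast_eq_intCast_iff, Surj_eq_sum, Surj_eq_sum]
  push_cast
  simp only [ZMod.pow_eq_pow_of_sub_one_dvd hi.ne' hj.ne' hdvd]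
end

section
/- Let p be a prime and let i, j be positive integers such that p − 1 does not divide j − i. Then there exists a positive integer ℓ with ℓ ≤ max(i,j) such that Surj(i,ℓ) ≢ Surj(j,ℓ) (mod p), where Surj(m,n) denotes the number of surjective functions from Fin m to Fin n. -/
theorem Surj_zero_right {m : ℕ} (hm : 0 < m) : Surj m 0 = 0 := by
  have : IsEmpty {f : Fin m → Fin 0 // Function.Surjective f} := ⟨fun f => (f.1 ⟨0, hm⟩).elim0⟩
  exact Nat.card_of_isEmpty

/-- Functions with image `s` correspond to surjections onto `Fin s.card`. -/
noncomputable def imageEqEquivSurjective {m n : ℕ} (s : Finset (Fin n)) :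
    {f : Fin m → Fin n // Finset.univ.image f = s} ≃
      {f : Fin m → Fin s.card // Function.Surjective f} where
  toFun f := ⟨fun x => s.equivFin ⟨f.1 x,
      f.2.subset (Finset.mem_image_of_mem _ (Finset.mem_univ x))⟩, fun y => by
    have hy : (s.equivFin.symm y).1 ∈ Finset.univ.image f.1 := by
      rw [f.2]
      exact (s.equivFin.symm y).2
    obtain ⟨x, -, hx⟩ := Finset.mem_image.1 hy
    exact ⟨x, by simp [hx]⟩⟩
  invFun g := ⟨fun x => (s.equivFin.symm (g.1 x)).1, by
    ext y
    simp only [Finset.mem_image, Finset.mem_univ, true_and]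
    constructor
    · rintro ⟨x, rfl⟩
      exact (s.equivFin.symm (g.1 x)).2
    · intro hy
      obtain ⟨x, hx⟩ := g.2 (s.equivFin ⟨y, hy⟩)
      exact ⟨x, by simp [hx]⟩⟩
  left_inv f := by
    ext x
    simp
  right_inv g := by
    ext x
    simp

theorem pow_eq_sum_Surj (m n : ℕ) : n ^ m = ∑ s : Finset (Fin n), Surj m s.card := by
  calc n ^ m = (Finset.univ : Finset (Fin m → Fin n)).card := by simp
    _ = ∑ s : Finset (Fin n),
          (Finset.univ.filter fun f : Fin m → Fin n => Finset.univ.image f = s).card :=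
        Finset.card_eq_sum_card_fiberwise fun _ _ => Finset.mem_coe.2 (Finset.mem_univ _)
    _ = ∑ s : Finset (Fin n), Surj m s.card := by
        refine Finset.sum_congr rfl fun s _ => ?_
        rw [Surj, ← Nat.card_congr (imageEqEquivSurjective s), Nat.card_eq_fintype_card,
          Fintype.card_subtype]

/-- If `p` is prime and `p − 1` does not divide `j − i`, then there exists a positive
integer `ℓ ≤ max(i,j)` such that `Surj(i,ℓ) ≢ Surj(j,ℓ) (mod p)`. -/
theorem surj_not_modEq (p : ℕ) (hp : p.Prime) (i j : ℕ) (hi : 0 < i) (hj : 0 < j)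
    (hndvd : ¬ ((p : ℤ) - 1) ∣ ((j : ℤ) - (i : ℤ))) :
    ∃ ℓ : ℕ, 0 < ℓ ∧ ℓ ≤ max i j ∧
      ¬ ((Surj i ℓ : ℤ) ≡ (Surj j ℓ : ℤ) [ZMOD (p : ℤ)]) := by
  have : Fact p.Prime := ⟨hp⟩
  by_contra! h
  have hSurj (ℓ : ℕ) : (Surj i ℓ : ZMod p) = Surj j ℓ := by
    rcases ℓ.eq_zero_or_pos with rfl | hpos
    · rw [Surj_zero_right hi, Surj_zero_right hj]
    · rcases le_or_gt ℓ (max i j) with hle | hlt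
      · exact_mod_cast (ZMod.intCast_eq_intCast_iff _ _ _).2 (h ℓ hpos hle)
      · rw [max_lt_iff] at hlt
        rw [Surj_eq_zero_of_lt hlt.1, Surj_eq_zero_of_lt hlt.2]
  have hpow (x : ZMod p) : x ^ i = x ^ j := by
    rw [← ZMod.natCast_zmod_val x, ← Nat.cast_pow, ← Nat.cast_pow, pow_eq_sum_Surj,
      pow_eq_sum_Surj, Nat.cast_sum, Nat.cast_sum]
    exact Finset.sum_congr rfl fun s _ => hSurj s.card
  obtain ⟨g, hg⟩ := IsCyclic.exists_ofOrder_eq_natCard (α := (ZMod p)ˣ)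
  have hgpow : g ^ i = g ^ j := Units.ext (by simpa using hpow g)
  rw [pow_eq_pow_iff_modEq, hg, Nat.card_eq_fintype_card, ZMod.card_units, Nat.modEq_iff_dvd,
    Nat.cast_sub hp.one_le] at hgpow
  exact hndvd (by exact_mod_cast hgpow)
end

section
/- Let p be a prime and let i, j be positive integers such that p − 1 does not divide j − i. Then there exists a positive integer ℓ with ℓ ≤ max(i,j) such that ℓ^i ≢ ℓ^j (mod p). -/
/-- In `ZMod p`, if the powers with exponents `i < j` agree at
`1, …, j`, then `p - 1` divides `j - i`. -/
lemma sub_one_dvd_sub_of_forall_pow_eq {p i j : ℕ} [Fact p.Prime] (hi : 0 < i) (hij : i < j)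
    (h : ∀ l : ℕ, 0 < l → l ≤ j → (l : ZMod p) ^ i = (l : ZMod p) ^ j) : p - 1 ∣ j - i := by
  have h_zero : ∀ l : ℕ, l ≤ j → (l : ZMod p) ^ i = (l : ZMod p) ^ j := by
    intro l hl
    rcases Nat.eq_zero_or_pos l with rfl | hl0
    · simp [hi.ne', (hi.trans hij).ne']
    · exact h l hl0 hl
  rcases lt_or_ge j p with hjp | hpj
  · exfalso
    have h_degree : (Polynomial.X ^ j - Polynomial.X ^ i : Polynomial (ZMod p)).natDegree = j := by
      rw [Polynomial.natDegree_sub_eq_left_of_natDegree_lt] <;> simp [hij]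
    have h_poly : (Polynomial.X ^ j - Polynomial.X ^ i : Polynomial (ZMod p)) = 0 := by
      refine Polynomial.eq_zero_of_natDegree_lt_card_of_eval_eq_zero _
        (f := fun l : Fin (j + 1) => ((l : ℕ) : ZMod p)) ?_ ?_ ?_
      · intro a b hab
        have hmod := (ZMod.natCast_eq_natCast_iff _ _ _).1 hab
        exact Fin.ext (hmod.eq_of_lt_of_lt (by omega) (by omega))
      · intro l
        simp [h_zero l (by omega)]
      · rw [h_degree]
        simp
    rw [h_poly, Polynomial.natDegree_zero] at h_degree
    omega
  · have h_units : ∀ u : (ZMod p)ˣ, u ^ (j - i) = 1 := by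
      intro u
      have hu := h_zero (u : ZMod p).val ((ZMod.val_lt _).le.trans hpj)
      rw [ZMod.natCast_zmod_val] at hu
      have hu' : u ^ i = u ^ j := Units.ext (by simpa using hu)
      rw [pow_sub u hij.le, ← hu', mul_inv_cancel]
    simpa [ZMod.card] using (FiniteField.forall_pow_eq_one_iff (ZMod p) (j - i)).1 h_units

/-- If `p` is prime and `p − 1` does not divide `j − i`, then there exists a positive
integer `ℓ ≤ max(i,j)` such that `ℓ^i ≢ ℓ^j (mod p)` in the integers. -/
theorem pow_not_modEq (p : ℕ) (hp : p.Prime) (i j : ℕ) (hi : 0 < i) (hj : 0 < j)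
    (hndvd : ¬ ((p : ℤ) - 1) ∣ ((j : ℤ) - (i : ℤ))) :
    ∃ ℓ : ℕ, 0 < ℓ ∧ ℓ ≤ max i j ∧
      ¬ (((ℓ : ℤ) ^ i) ≡ ((ℓ : ℤ) ^ j) [ZMOD (p : ℤ)]) := by
  have : Fact p.Prime := ⟨hp⟩
  by_contra! hall
  have h : ∀ l : ℕ, 0 < l → l ≤ max i j → (l : ZMod p) ^ i = (l : ZMod p) ^ j := by
    intro l hl hlj
    simpa using (ZMod.intCast_eq_intCast_iff _ _ _).2 (hall l hl hlj)
  apply hndvd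
  rcases lt_trichotomy i j with hij | rfl | hji
  · rw [max_eq_right hij.le] at h
    have hdvd := Int.natCast_dvd_natCast.2 (sub_one_dvd_sub_of_forall_pow_eq hi hij h)
    rwa [Nat.cast_sub hp.one_le, Nat.cast_sub hij.le, Nat.cast_one] at hdvd
  · simp
  · rw [max_eq_left hji.le] at h
    have hdvd := Int.natCast_dvd_natCast.2
      (sub_one_dvd_sub_of_forall_pow_eq hj hji fun l hl hli => (h l hl hli).symm)
    rw [Nat.cast_sub hp.one_le, Nat.cast_sub hji.le, Nat.cast_one] at hdvd
    exact (dvd_sub_comm).1 hdvd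
end

section
/- Let p be a prime and let k, l be positive integers. Then k can be written as a sum of l powers of p (i.e., there exists f : Fin l → ℕ with k = ∑_{t} p^(f t), where p^0 = 1 is allowed) if and only if k ≥ l, p − 1 divides k − l, and l ≥ s_p(k), where s_p(k) is the sum of the digits of the base-p expansion of k. -/
/-- `k` is a sum of `l` powers of `p` if there is `f : Fin l → ℕ` with `k = ∑ t, p ^ f t`
(the power `p^0 = 1` is allowed). -/
def IsSumPowers (p k l : ℕ) : Prop :=
  ∃ f : Fin l → ℕ, k = ∑ t, p ^ (f t)

theorem digits_sum_eq_mod_add_div {p : ℕ} (hp : 1 < p) (n : ℕ) :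
    (Nat.digits p n).sum = n % p + (Nat.digits p (n / p)).sum := by
  rcases Nat.eq_zero_or_pos n with rfl | hn
  · simp
  · rw [Nat.digits_def' hp hn, List.sum_cons]

theorem digits_sum_succ_le {p : ℕ} (hp : 1 < p) (n : ℕ) :
    (Nat.digits p (n + 1)).sum ≤ (Nat.digits p n).sum + 1 := by
  induction n using Nat.strong_induction_on with
  | _ n ih =>
    rw [digits_sum_eq_mod_add_div hp (n + 1), digits_sum_eq_mod_add_div hp n, Nat.succ_div]
    split_ifs with hdvd
    · have hn : 0 < n := by
        by_contra! hn
        have := Nat.le_of_dvd n.succ_pos hdvd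
        omega
      have := ih (n / p) (Nat.div_lt_self hn hp)
      rw [Nat.mod_eq_zero_of_dvd hdvd]
      omega
    · have := Nat.mod_le (n % p + 1) p
      rw [Nat.mod_add_mod] at this
      rw [add_zero]
      omega

theorem digits_sum_pow_add_le {p : ℕ} (hp : 1 < p) (i n : ℕ) :
    (Nat.digits p (p ^ i + n)).sum ≤ (Nat.digits p n).sum + 1 := by
  induction i generalizing n with
  | zero => simpa [add_comm] using digits_sum_succ_le hp n
  | succ i ih =>
    rw [digits_sum_eq_mod_add_div hp (p ^ (i + 1) + n), digits_sum_eq_mod_add_div hp n, pow_succ',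
      Nat.mul_add_mod, Nat.mul_add_div (by omega)]
    have := ih (n / p)
    omega

namespace IsSumPowers

variable {p k l : ℕ}

theorem digits_sum_le (hp : 1 < p) (h : IsSumPowers p k l) : (Nat.digits p k).sum ≤ l := by
  obtain ⟨f, rfl⟩ := h
  induction l with
  | zero => simp
  | succ l ih =>
    rw [Fin.sum_univ_succ]
    exact (digits_sum_pow_add_le hp _ _).trans (Nat.succ_le_succ (ih _))

theorem exists_eq_add_mul (hp : 1 < p) (h : IsSumPowers p k l) : ∃ c, k = l + (p - 1) * c := by
  obtain ⟨f, rfl⟩ := h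
  have hf (t : Fin l) : ∃ c, p ^ f t = 1 + (p - 1) * c := by
    obtain ⟨c, hc⟩ := Nat.sub_one_dvd_pow_sub_one p (f t)
    have := Nat.one_le_pow (f t) p (by omega)
    exact ⟨c, by omega⟩
  choose c hc using hf
  exact ⟨∑ t, c t, by simp [hc, Finset.sum_add_distrib, Finset.mul_sum]⟩

theorem add {k' l' : ℕ} (h : IsSumPowers p k l) (h' : IsSumPowers p k' l') :
    IsSumPowers p (k + k') (l + l') := by
  obtain ⟨f, rfl⟩ := h
  obtain ⟨g, rfl⟩ := h'
  exact ⟨Fin.append f g, by simp [Fin.sum_univ_add]⟩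

theorem base_mul (h : IsSumPowers p k l) : IsSumPowers p (p * k) l := by
  obtain ⟨f, rfl⟩ := h
  exact ⟨fun t => f t + 1, by simp [pow_succ', Finset.mul_sum]⟩

theorem mul_pow (p l i : ℕ) : IsSumPowers p (l * p ^ i) l :=
  ⟨fun _ => i, by simp⟩

theorem self_digits_sum (hp : 1 < p) (k : ℕ) : IsSumPowers p k (Nat.digits p k).sum := by
  induction k using Nat.strong_induction_on with
  | _ k ih =>
    rcases Nat.eq_zero_or_pos k with rfl | hk
    · exact ⟨fun _ => 0, by simp⟩
    · have h := (mul_pow p (k % p) 0).add (ih (k / p) (Nat.div_lt_self hk hp)).base_mul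
      rwa [pow_zero, mul_one, Nat.mod_add_div, ← digits_sum_eq_mod_add_div hp] at h

/-- One of the powers `p ^ (i + 1)` is replaced by `p` copies of `p ^ i`. -/
theorem add_sub_one (hp : 1 < p) (h : IsSumPowers p k l) (hlk : l < k) :
    IsSumPowers p k (l + (p - 1)) := by
  obtain ⟨f, rfl⟩ := h
  obtain ⟨t, ht⟩ : ∃ t, f t ≠ 0 := by
    by_contra! hf
    simp [hf] at hlk
  obtain ⟨i, hi⟩ := Nat.exists_eq_succ_of_ne_zero ht
  have hsum : ∑ s, p ^ f s = ∑ s, p ^ Function.update f t i s + (p - 1) * p ^ i := by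
    rw [← Finset.add_sum_erase _ _ (Finset.mem_univ t),
      ← Finset.add_sum_erase _ (fun s => p ^ Function.update f t i s) (Finset.mem_univ t),
      Finset.sum_congr rfl fun s hs => show p ^ Function.update f t i s = p ^ f s by
        rw [Function.update_of_ne (Finset.ne_of_mem_erase hs)]]
    obtain ⟨q, rfl⟩ := Nat.exists_eq_add_of_lt hp
    simp only [hi, Function.update_self, Nat.succ_eq_add_one, pow_succ, Nat.add_sub_cancel]
    ring
  rw [hsum]
  exact add ⟨_, rfl⟩ (mul_pow p (p - 1) i)

theorem add_mul_sub_one (hp : 1 < p) (h : IsSumPowers p k l) (m : ℕ)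
    (hm : l + (p - 1) * m ≤ k) : IsSumPowers p k (l + (p - 1) * m) := by
  induction m with
  | zero => simpa using h
  | succ m ih =>
    rw [mul_add_one, ← add_assoc] at hm ⊢
    exact (ih (by omega)).add_sub_one hp (by omega)

end IsSumPowers

/-- `k` can be written as a sum of `l` powers of `p` if and only if `k ≥ l`,
`p − 1` divides `k − l`, and `l ≥ s_p(k)`, the base-`p` digit sum of `k`. -/
theorem isSumPowers_iff (p : ℕ) (hp : p.Prime) (k l : ℕ) (hk : 0 < k) (hl : 0 < l) :
    IsSumPowers p k l ↔
      l ≤ k ∧ (p - 1) ∣ (k - l) ∧ (Nat.digits p k).sum ≤ l := by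
  constructor
  · intro h
    obtain ⟨c, hc⟩ := h.exists_eq_add_mul hp.one_lt
    exact ⟨by omega, ⟨c, by omega⟩, h.digits_sum_le hp.one_lt⟩
  · rintro ⟨hlk, hdvd, hle⟩
    have h := IsSumPowers.self_digits_sum hp.one_lt k
    obtain ⟨c, hc⟩ := h.exists_eq_add_mul hp.one_lt
    obtain ⟨m, hm⟩ : p - 1 ∣ l - (Nat.digits p k).sum := by
      have := Nat.dvd_sub (Dvd.intro c rfl : p - 1 ∣ (p - 1) * c) hdvd
      rwa [show (p - 1) * c - (k - l) = l - (Nat.digits p k).sum by omega] at this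
    have hl' : l = (Nat.digits p k).sum + (p - 1) * m := by omega
    rw [hl']
    exact h.add_mul_sub_one hp.one_lt m (by omega)
end

section
/- Let p be a prime and let k, l be positive integers with 0 < l < s_p(k) and p − 1 dividing k − l. Then there exists a positive integer i < k such that p − 1 divides k − i (hence i is congruent to both k and l modulo p − 1), i ≥ s_p(k), and l ≥ s_p(i), where s_p denotes the base-p digit sum. -/
/-- Isolating the last digit: `k` exceeds `p (s_p(k) - (p - 1))`. -/
theorem base_mul_digits_sum_lt (p k : ℕ) (hp : 1 < p) (hk : 0 < k) :
    p * (Nat.digits p k).sum < k + p * (p - 1) := by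
  have hsum : (Nat.digits p k).sum = k % p + (Nat.digits p (k / p)).sum := by
    rw [Nat.digits_def' hp hk, List.sum_cons]
  have hquot := Nat.digit_sum_le p (k / p)
  have hmod := Nat.mod_lt k (by omega : 0 < p)
  have hdiv := Nat.mod_add_div k p
  obtain ⟨q, rfl⟩ : ∃ q, p = q + 1 := ⟨p - 1, by omega⟩
  rw [hsum, Nat.add_sub_cancel]
  nlinarith

/-- Multiplying by a power of the base only appends zero digits. -/
theorem digits_sum_base_pow_mul (p j l : ℕ) (hp : 1 < p) (hl : 0 < l) :
    (Nat.digits p (p ^ j * l)).sum = (Nat.digits p l).sum := by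
  simp [Nat.digits_base_pow_mul hp hl]

/-- A power of `p` is `1` modulo `p - 1`. -/
theorem base_pow_mul_modEq (p j l : ℕ) (hp : 0 < p) : p ^ j * l ≡ l [MOD p - 1] := by
  have h : p ≡ 1 [MOD p - 1] := ((Nat.modEq_iff_dvd' hp).2 dvd_rfl).symm
  simpa using (h.pow j).mul_right l

/-- Casting out `p - 1`: valid for every base, including `p = 2`, where the modulus is `1`. -/
theorem modEq_digits_sum_base_sub_one (p k : ℕ) (hp : 0 < p) :
    k ≡ (Nat.digits p k).sum [MOD p - 1] := by
  have h : p ≡ 1 [MOD p - 1] := ((Nat.modEq_iff_dvd' hp).2 dvd_rfl).symm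
  simpa [Nat.ofDigits_digits, Nat.ofDigits_one] using
    Nat.ofDigits_modEq' p 1 (p - 1) h (Nat.digits p k)

/-- If `p` is prime, `0 < l < s_p(k)` and `p − 1 ∣ k − l`, then there exists a positive
integer `i < k` congruent to `k` (and hence to `l`) modulo `p − 1` with `i ≥ s_p(k)` and
`l ≥ s_p(i)`, where `s_p` is the base-`p` digit sum. -/
theorem exists_intermediate (p : ℕ) (hp : p.Prime) (k l : ℕ) (hk : 0 < k) (hl : 0 < l)
    (hls : l < (Nat.digits p k).sum) (hdvd : (p - 1) ∣ (k - l)) :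
    ∃ i : ℕ, 0 < i ∧ i < k ∧ (p - 1) ∣ (k - i) ∧ (p - 1) ∣ (i - l) ∧
      (Nat.digits p k).sum ≤ i ∧ (Nat.digits p i).sum ≤ l := by
  have hp1 := hp.one_lt
  set s := (Nat.digits p k).sum with hs
  have hsk : s ≤ k := Nat.digit_sum_le p k
  have hlk : l ≡ k [MOD p - 1] := (Nat.modEq_iff_dvd' (by omega)).2 hdvd
  have hks : k ≡ s [MOD p - 1] :=
    modEq_digits_sum_base_sub_one p k hp.pos
  have hex : ∃ j, s ≤ p ^ j * l :=
    ⟨s, (Nat.lt_pow_self hp1).le.trans (Nat.le_mul_of_pos_right _ hl)⟩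
  obtain ⟨j, hj, hmin⟩ : ∃ j, s ≤ p ^ (j + 1) * l ∧ p ^ j * l < s := by
    classical
    obtain ⟨j, hj⟩ : ∃ j, Nat.find hex = j + 1 := by
      refine Nat.exists_eq_succ_of_ne_zero fun h => ?_
      have := Nat.find_spec hex
      rw [h, pow_zero, one_mul] at this
      omega
    exact ⟨j, hj ▸ Nat.find_spec hex, not_le.1 (Nat.find_min hex (by omega))⟩
  have hgap : p ^ j * l + (p - 1) ≤ s := by
    have hd := (Nat.modEq_iff_dvd' hmin.le).1
      ((base_pow_mul_modEq p j l hp.pos).trans (hlk.trans hks))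
    have := Nat.le_of_dvd (by omega) hd
    omega
  have hlt : p ^ (j + 1) * l < k := by
    have h := base_mul_digits_sum_lt p k hp1 hk
    have h' := Nat.mul_le_mul_left p hgap
    rw [← hs] at h
    rw [pow_succ', mul_assoc]
    rw [mul_add] at h'
    omega
  have hil := base_pow_mul_modEq p (j + 1) l hp.pos
  refine ⟨p ^ (j + 1) * l, by omega, hlt, (Nat.modEq_iff_dvd' hlt.le).1 (hil.trans hlk),
    (Nat.modEq_iff_dvd' (by omega)).1 hil.symm, hj, ?_⟩
  rw [digits_sum_base_pow_mul p _ l hp1 hl]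
  exact Nat.digit_sum_le p l
end

section
/- Let p be a prime, k a positive integer, and a : ℕ → ℕ a finitely supported function with k = ∑_i a(i) · p^i. Then ∑_i a(i) ≥ s_p(k), where s_p(k) is the base-p digit sum of k; moreover equality holds if and only if a(i) is the i-th digit of the base-p expansion of k for every i (equivalently, if and only if a(i) < p for all i). -/
open Finset

theorem Nat.sum_digits_eq_mod_add_sum_digits_div {p : ℕ} (hp : 1 < p) (k : ℕ) :
    (Nat.digits p k).sum = k % p + (Nat.digits p (k / p)).sum := by
  rcases k.eq_zero_or_pos with rfl | hk
  · simp
  · rw [Nat.digits_def' hp hk, List.sum_cons]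

theorem sum_range_succ_mul_pow (p n : ℕ) (f : ℕ → ℕ) :
    ∑ i ∈ range (n + 1), f i * p ^ i = f 0 + p * ∑ i ∈ range n, f (i + 1) * p ^ i := by
  rw [sum_range_succ', mul_sum, add_comm]
  simp only [pow_succ, pow_zero, mul_one]
  congr 1
  exact sum_congr rfl fun i _ => by ring

/-- The bound on the digit sum of `∑ i, f i * p ^ i`, generalized by a carry `c` so that it can be
proved by induction on the number of terms. -/
theorem sum_digits_add_sum_mul_pow_le {p : ℕ} (hp : 1 < p) (n : ℕ) (f : ℕ → ℕ) (c : ℕ) :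
    (Nat.digits p (c + ∑ i ∈ range n, f i * p ^ i)).sum ≤ c + ∑ i ∈ range n, f i ∧
    (c + ∑ i ∈ range n, f i = (Nat.digits p (c + ∑ i ∈ range n, f i * p ^ i)).sum →
      ∀ i < n, f i < p) := by
  induction n generalizing f c with
  | zero => simpa using Nat.digit_sum_le p c
  | succ n ih =>
    obtain ⟨hle, heq⟩ := ih (fun i => f (i + 1)) ((c + f 0) / p)
    rw [sum_range_succ_mul_pow, sum_range_succ' f, ← add_assoc,
      Nat.sum_digits_eq_mod_add_sum_digits_div hp, Nat.add_mul_mod_self_left,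
      Nat.add_mul_div_left _ _ (by lia)]
    have hdiv := Nat.mod_add_div (c + f 0) p
    have hmul : 2 * ((c + f 0) / p) ≤ p * ((c + f 0) / p) := Nat.mul_le_mul_right _ hp
    refine ⟨by lia, fun h i hi => ?_⟩
    cases i with
    | zero =>
      have hzero : (c + f 0) / p = 0 := by lia
      have := (Nat.div_eq_zero_iff_lt (by lia)).mp hzero
      lia
    | succ i => exact heq (by lia) i (by lia)

theorem sum_digits_sum_mul_pow {p : ℕ} (hp : 1 < p) (n : ℕ) (f : ℕ → ℕ) (hf : ∀ i, f i < p) :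
    (Nat.digits p (∑ i ∈ range n, f i * p ^ i)).sum = ∑ i ∈ range n, f i := by
  induction n generalizing f with
  | zero => simp
  | succ n ih =>
    rw [sum_range_succ_mul_pow, sum_range_succ' f, Nat.sum_digits_eq_mod_add_sum_digits_div hp,
      Nat.add_mul_mod_self_left, Nat.add_mul_div_left _ _ (by lia), Nat.mod_eq_of_lt (hf 0),
      Nat.div_eq_of_lt (hf 0), zero_add, ih _ fun i => hf (i + 1), add_comm]

theorem sum_mul_pow_div_pow_mod {p n : ℕ} {f : ℕ → ℕ} (hf : ∀ i, f i < p)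
    (hn : ∀ i, n ≤ i → f i = 0) (i : ℕ) :
    (∑ j ∈ range n, f j * p ^ j) / p ^ i % p = f i := by
  induction n generalizing f i with
  | zero => simp [hn i]
  | succ n ih =>
    have hp : 0 < p := (Nat.zero_le _).trans_lt (hf 0)
    rw [sum_range_succ_mul_pow]
    cases i with
    | zero => rw [pow_zero, Nat.div_one, Nat.add_mul_mod_self_left, Nat.mod_eq_of_lt (hf 0)]
    | succ i =>
      rw [pow_succ', ← Nat.div_div_eq_div_mul, Nat.add_mul_div_left _ _ hp,
        Nat.div_eq_of_lt (hf 0), zero_add]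
      exact ih (f := fun j => f (j + 1)) (fun j => hf (j + 1))
        (fun j hj => hn (j + 1) (by lia)) i

/-- If `a : ℕ →₀ ℕ` is a finitely supported function with `k = ∑ i, a i * p ^ i`, then the
sum of the values of `a` is at least the base-`p` digit sum `s_p(k)` of `k`; moreover
equality holds iff `a i` is the `i`-th base-`p` digit of `k` for every `i`, equivalently
iff `a i < p` for all `i`. -/
theorem digitSum_le_weight (p : ℕ) (hp : p.Prime) (k : ℕ) (hk : 0 < k) (a : ℕ →₀ ℕ)
    (ha : k = a.sum fun i c => c * p ^ i) :
    (Nat.digits p k).sum ≤ a.sum (fun _ c => c) ∧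
    (a.sum (fun _ c => c) = (Nat.digits p k).sum ↔
      ∀ i, a i = (Nat.digits p k).getD i 0) ∧
    (a.sum (fun _ c => c) = (Nat.digits p k).sum ↔ ∀ i, a i < p) := by
  obtain ⟨n, hn⟩ := a.support.exists_nat_subset_range
  have hsum : a.sum (fun _ c => c) = ∑ i ∈ range n, a i :=
    a.sum_of_support_subset hn _ (by simp)
  rw [a.sum_of_support_subset hn _ (by simp)] at ha
  have hzero : ∀ i, n ≤ i → a i = 0 := fun i hi =>
    Finsupp.notMem_support_iff.mp fun h => by simpa [hi.not_gt] using hn h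
  have hp1 := hp.one_lt
  obtain ⟨hle, heq⟩ := sum_digits_add_sum_mul_pow_le hp1 n a 0
  simp only [zero_add, ← ha, ← hsum] at hle heq
  have hiff : a.sum (fun _ c => c) = (Nat.digits p k).sum ↔ ∀ i, a i < p := by
    refine ⟨fun h i => ?_, fun h => ?_⟩
    · rcases lt_or_ge i n with hi | hi
      · exact heq h i hi
      · rw [hzero i hi]
        exact hp.pos
    · rw [hsum, ha, sum_digits_sum_mul_pow hp1 n a h]
  refine ⟨hle, hiff.trans ⟨fun h i => ?_, fun h i => ?_⟩, hiff⟩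
  · rw [Nat.getD_digits _ _ hp1, ha, sum_mul_pow_div_pow_mod h hzero]
  · rw [h i, Nat.getD_digits _ _ hp1]
    exact Nat.mod_lt _ hp.pos
end

section
/- For all positive integers i, j and every natural number k, the number μ(i,j,k) of good subsets of Fin i × Fin j of cardinality k is nonzero if and only if max(i,j) ≤ k ≤ i·j; moreover μ(i,j,i·j) = 1. -/
theorem mu_ne_zero_iff_exists (i j k : ℕ) :
    mu i j k ≠ 0 ↔ ∃ U : Finset (Fin i × Fin j),
      U.image Prod.fst = Finset.univ ∧ U.image Prod.snd = Finset.univ ∧ U.card = k := by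
  simp [mu, Finset.filter_eq_empty_iff]

/-- The staircase `(min t (i - 1), min t (j - 1))`, `t < max i j`, is a good set. -/
theorem exists_good_card_le_max {i j : ℕ} (hi : 0 < i) (hj : 0 < j) :
    ∃ U : Finset (Fin i × Fin j),
      U.image Prod.fst = Finset.univ ∧ U.image Prod.snd = Finset.univ ∧ U.card ≤ max i j := by
  let f : ℕ → Fin i × Fin j := fun t => (⟨min t (i - 1), by omega⟩, ⟨min t (j - 1), by omega⟩)
  refine ⟨(Finset.range (max i j)).image f, ?_, ?_, ?_⟩
  · refine Finset.eq_univ_of_forall fun a => ?_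
    rw [Finset.image_image]
    refine Finset.mem_image.2 ⟨a, Finset.mem_range.2 (by omega), Fin.ext ?_⟩
    change min a.val (i - 1) = a
    omega
  · refine Finset.eq_univ_of_forall fun b => ?_
    rw [Finset.image_image]
    refine Finset.mem_image.2 ⟨b, Finset.mem_range.2 (by omega), Fin.ext ?_⟩
    change min b.val (j - 1) = b
    omega
  · simpa using Finset.card_image_le (s := Finset.range (max i j)) (f := f)

/-- `μ(i,j,k) ≠ 0` if and only if `max(i,j) ≤ k ≤ i·j`; moreover `μ(i,j,ij) = 1`. -/
theorem mu_ne_zero_iff (i j : ℕ) (hi : 0 < i) (hj : 0 < j) (k : ℕ) :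
    (mu i j k ≠ 0 ↔ max i j ≤ k ∧ k ≤ i * j) ∧ mu i j (i * j) = 1 := by
  have card_univ : (Finset.univ : Finset (Fin i × Fin j)).card = i * j := by simp
  obtain ⟨S, hS₁, hS₂, hS⟩ := exists_good_card_le_max hi hj
  have good_of_superset {U : Finset (Fin i × Fin j)} (h : S ⊆ U) :
      U.image Prod.fst = Finset.univ ∧ U.image Prod.snd = Finset.univ :=
    ⟨Finset.univ_subset_iff.1 (hS₁ ▸ Finset.image_subset_image h),
      Finset.univ_subset_iff.1 (hS₂ ▸ Finset.image_subset_image h)⟩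
  constructor
  · rw [mu_ne_zero_iff_exists]
    constructor
    · rintro ⟨U, h₁, h₂, rfl⟩
      refine ⟨max_le ?_ ?_, card_univ ▸ Finset.card_le_univ U⟩
      · simpa [h₁] using Finset.card_image_le (s := U) (f := Prod.fst)
      · simpa [h₂] using Finset.card_image_le (s := U) (f := Prod.snd)
    · rintro ⟨hk, hk'⟩
      obtain ⟨U, hU, -, hc⟩ := Finset.exists_subsuperset_card_eq (Finset.subset_univ S)
        (hS.trans hk) (hk'.trans_eq card_univ.symm)
      exact ⟨U, (good_of_superset hU).1, (good_of_superset hU).2, hc⟩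
  · refine Finset.card_eq_one.2 ⟨Finset.univ, Finset.ext fun U => ?_⟩
    simp only [Finset.mem_filter, Finset.mem_univ, true_and, Finset.mem_singleton]
    constructor
    · rintro ⟨-, -, h⟩
      exact Finset.eq_univ_of_card U (by simpa using h)
    · rintro rfl
      exact ⟨(good_of_superset S.subset_univ).1, (good_of_superset S.subset_univ).2, card_univ⟩
end
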